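/- arXiv:2503.14165 — 2 statements merged into one kernel-verified Lean document; each statement's English description precedes it below -/
import Mathlib

section
/- Let (A0, A1, d, ·) be a strict associative 2-algebra and let R0 : A0 → A0, R1 : A1 → A1 be linear maps with R0∘d = d∘R1 such that for all x,y ∈ A0, a ∈ A1: R0(R0(x)·y + x·R0(y)) = R0(x)·R0(y); R1(R0(x)·a + x·R1(a)) = R0(x)·R1(a); R1(R1(a)·x + a·R0(x)) = R1(a)·R0(x) (i.e. (R0,R1) is a Rota–Baxter operator of weight 0). Define new multiplications by x∘y = R0(x)·y − y·R0(x), x∘a = R0(x)·a − a·R0(x), a∘x = R1(a)·x − x·R1(a). Then (A0, A1, d, ∘) is a strict pre-Lie 2-algebra. -/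
namespace PreLie2

open Module TensorProduct

variable (K : Type*) [Field K]

/-- A two-argument map between modules is bilinear. -/
def IsBilin {M N P : Type*} [AddCommGroup M] [Module K M] [AddCommGroup N] [Module K N]
    [AddCommGroup P] [Module K P] (f : M → N → P) : Prop :=
  (∀ m, IsLinearMap K (f m)) ∧ ∀ n, IsLinearMap K fun m => f m n

section TwoTerm

variable {A0 A1 : Type*} [AddCommGroup A0] [Module K A0] [AddCommGroup A1] [Module K A1]

/-- A strict pre-Lie `2`-algebra structure on the two-term complex `d : A1 → A0`. -/
structure IsStrictPreLie2 (d : A1 → A0) (m00 : A0 → A0 → A0)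
    (m01 : A0 → A1 → A1) (m10 : A1 → A0 → A1) : Prop where
  d_lin : IsLinearMap K d
  m00_bilin : IsBilin K m00
  m01_bilin : IsBilin K m01
  m10_bilin : IsBilin K m10
  d_m01 : ∀ x a, d (m01 x a) = m00 x (d a)
  d_m10 : ∀ a x, d (m10 a x) = m00 (d a) x
  d_mix : ∀ a b, m01 (d a) b = m10 a (d b)
  preLie0 : ∀ x y z, m00 x (m00 y z) - m00 (m00 x y) z = m00 y (m00 x z) - m00 (m00 y x) z
  preLie1 : ∀ x y a, m01 x (m01 y a) - m01 (m00 x y) a = m01 y (m01 x a) - m01 (m00 y x) a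
  preLie2 : ∀ a x y, m10 a (m00 x y) - m10 (m10 a x) y = m01 x (m10 a y) - m10 (m01 x a) y

/-- A strict Lie `2`-algebra structure on the two-term complex `δ : A1 → A0`. -/
structure IsStrictLie2 (δ : A1 → A0) (br0 : A0 → A0 → A0) (br1 : A0 → A1 → A1) : Prop where
  δ_lin : IsLinearMap K δ
  br0_bilin : IsBilin K br0
  br1_bilin : IsBilin K br1
  skew : ∀ x y, br0 x y = -br0 y x
  δ_br1 : ∀ x a, δ (br1 x a) = br0 x (δ a)
  br1_δ : ∀ a b, br1 (δ a) b = -br1 (δ b) a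
  jacobi0 : ∀ x y z, br0 (br0 x y) z + br0 (br0 y z) x + br0 (br0 z x) y = 0
  jacobi1 : ∀ x y b, br1 x (br1 y b) - br1 y (br1 x b) - br1 (br0 x y) b = 0

/-- A strict associative `2`-algebra structure on the two-term complex `d : A1 → A0`. -/
structure IsStrictAssoc2 (d : A1 → A0) (m00 : A0 → A0 → A0)
    (m01 : A0 → A1 → A1) (m10 : A1 → A0 → A1) : Prop where
  d_lin : IsLinearMap K d
  m00_bilin : IsBilin K m00
  m01_bilin : IsBilin K m01
  m10_bilin : IsBilin K m10
  d_m01 : ∀ x a, d (m01 x a) = m00 x (d a)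
  d_m10 : ∀ a x, d (m10 a x) = m00 (d a) x
  d_mix : ∀ a b, m01 (d a) b = m10 a (d b)
  assoc000 : ∀ x y z, m00 x (m00 y z) = m00 (m00 x y) z
  assoc001 : ∀ x y a, m01 x (m01 y a) = m01 (m00 x y) a
  assoc010 : ∀ x a y, m01 x (m10 a y) = m10 (m01 x a) y
  assoc100 : ∀ a x y, m10 a (m00 x y) = m10 (m10 a x) y

end TwoTerm

/-- A pre-Lie algebra structure. -/
structure IsPreLie {B : Type*} [AddCommGroup B] [Module K B] (mul : B → B → B) : Prop where
  bilin : IsBilin K mul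
  preLie : ∀ x y z, mul (mul x y) z - mul x (mul y z) = mul (mul y x) z - mul y (mul x z)

section Rep

variable {g0 g1 V0 V1 : Type*}
  [AddCommGroup g0] [Module K g0] [AddCommGroup g1] [Module K g1]
  [AddCommGroup V0] [Module K V0] [AddCommGroup V1] [Module K V1]

/-- A strict representation of a strict Lie 2-algebra `(g0, g1, δ, br0, br1)` on the
two-term complex `par : V1 → V0`. -/
structure IsStrictRepLie2 (δ : g1 → g0) (br0 : g0 → g0 → g0) (br1 : g0 → g1 → g1)
    (par : V1 → V0) (ρ00 : g0 → V0 → V0) (ρ01 : g0 → V1 → V1) (ρ1 : g1 → V0 → V1) : Prop where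
  ρ00_bilin : IsBilin K ρ00
  ρ01_bilin : IsBilin K ρ01
  ρ1_bilin : IsBilin K ρ1
  chain : ∀ x m, ρ00 x (par m) = par (ρ01 x m)
  comp0 : ∀ a v, ρ00 (δ a) v = par (ρ1 a v)
  comp1 : ∀ a m, ρ01 (δ a) m = ρ1 a (par m)
  rep00 : ∀ x y v, ρ00 (br0 x y) v = ρ00 x (ρ00 y v) - ρ00 y (ρ00 x v)
  rep01 : ∀ x y m, ρ01 (br0 x y) m = ρ01 x (ρ01 y m) - ρ01 y (ρ01 x m)
  rep1 : ∀ x a v, ρ1 (br1 x a) v = ρ01 x (ρ1 a v) - ρ1 a (ρ00 x v)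

/-- A strict representation of a strict pre-Lie 2-algebra `(g0, g1, d, m00, m01, m10)` on the
two-term complex `par : V1 → V0`. -/
structure IsStrictRepPreLie2 (d : g1 → g0) (m00 : g0 → g0 → g0) (m01 : g0 → g1 → g1)
    (m10 : g1 → g0 → g1) (par : V1 → V0)
    (ρ00 : g0 → V0 → V0) (ρ01 : g0 → V1 → V1) (ρ1 : g1 → V0 → V1)
    (μ00 : g0 → V0 → V0) (μ01 : g0 → V1 → V1) (μ1 : g1 → V0 → V1) : Prop where
  toRepLie : IsStrictRepLie2 K d (fun x y => m00 x y - m00 y x)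
    (fun x a => m01 x a - m10 a x) par ρ00 ρ01 ρ1
  μ00_bilin : IsBilin K μ00
  μ01_bilin : IsBilin K μ01
  μ1_bilin : IsBilin K μ1
  μchain : ∀ x m, μ00 x (par m) = par (μ01 x m)
  μcomp0 : ∀ a v, μ00 (d a) v = par (μ1 a v)
  μcomp1 : ∀ a m, μ01 (d a) m = μ1 a (par m)
  eqA0 : ∀ x y v, μ00 (m00 x y) v + μ00 y (ρ00 x v) - ρ00 x (μ00 y v) - μ00 y (μ00 x v) = 0
  eqA1 : ∀ x y m, μ01 (m00 x y) m + μ01 y (ρ01 x m) - ρ01 x (μ01 y m) - μ01 y (μ01 x m) = 0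
  eqB : ∀ x a v, μ1 (m01 x a) v - ρ01 x (μ1 a v) + μ1 a (ρ00 x v) - μ1 a (μ00 x v) = 0
  eqC : ∀ a x v, μ1 (m10 a x) v - ρ1 a (μ00 x v) + μ01 x (ρ1 a v) - μ01 x (μ1 a v) = 0

/-- An `O`-operator on a strict Lie 2-algebra associated to a strict representation. -/
structure IsOOperator (δ : g1 → g0) (br0 : g0 → g0 → g0) (br1 : g0 → g1 → g1)
    (par : V1 → V0) (ρ00 : g0 → V0 → V0) (ρ01 : g0 → V1 → V1) (ρ1 : g1 → V0 → V1)
    (T0 : V0 → g0) (T1 : V1 → g1) : Prop where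
  T0_lin : IsLinearMap K T0
  T1_lin : IsLinearMap K T1
  chain : ∀ m, T0 (par m) = δ (T1 m)
  eq0 : ∀ u v, T0 (ρ00 (T0 u) v - ρ00 (T0 v) u) = br0 (T0 u) (T0 v)
  eq1 : ∀ m v, T1 (ρ1 (T1 m) v - ρ01 (T0 v) m) = -br1 (T0 v) (T1 m)

end Rep

section Matched

variable {g0 g1 h0 h1 : Type*}
  [AddCommGroup g0] [Module K g0] [AddCommGroup g1] [Module K g1]
  [AddCommGroup h0] [Module K h0] [AddCommGroup h1] [Module K h1]

/-- A matched pair of strict Lie 2-algebras. -/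
structure IsMatchedPairLie2
    (δ : g1 → g0) (br0 : g0 → g0 → g0) (br1 : g0 → g1 → g1)
    (δ' : h1 → h0) (br0' : h0 → h0 → h0) (br1' : h0 → h1 → h1)
    (ν00 : g0 → h0 → h0) (ν01 : g0 → h1 → h1) (ν1 : g1 → h0 → h1)
    (ν00' : h0 → g0 → g0) (ν01' : h0 → g1 → g1) (ν1' : h1 → g0 → g1) : Prop where
  lie : IsStrictLie2 K δ br0 br1
  lie' : IsStrictLie2 K δ' br0' br1'
  rep : IsStrictRepLie2 K δ br0 br1 δ' ν00 ν01 ν1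
  rep' : IsStrictRepLie2 K δ' br0' br1' δ ν00' ν01' ν1'
  eqL1 : ∀ x' x y, ν00' x' (br0 x y) =
      br0 x (ν00' x' y) + br0 (ν00' x' x) y + ν00' (ν00 y x') x - ν00' (ν00 x x') y
  eqL2 : ∀ x x' y', ν00 x (br0' x' y') =
      br0' x' (ν00 x y') + br0' (ν00 x x') y' + ν00 (ν00' y' x) x' - ν00 (ν00' x' x) y'
  eqL3 : ∀ h' x y, ν1' h' (br0 x y) =
      br1 x (ν1' h' y) - br1 y (ν1' h' x) + ν1' (ν01 y h') x - ν1' (ν01 x h') y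
  eqL4 : ∀ h x' y', ν1 h (br0' x' y') =
      br1' x' (ν1 h y') - br1' y' (ν1 h x') + ν1 (ν01' y' h) x' - ν1 (ν01' x' h) y'
  eqL5 : ∀ x' x h, ν01' x' (br1 x h) =
      br1 x (ν01' x' h) + br1 (ν00' x' x) h + ν1' (ν1 h x') x - ν01' (ν00 x x') h
  eqL6 : ∀ x x' h', ν01 x (br1' x' h') =
      br1' x' (ν01 x h') + br1' (ν00 x x') h' + ν1 (ν1' h' x) x' - ν01 (ν00' x' x) h'

/-- A matched pair of strict pre-Lie 2-algebras. -/
structure IsMatchedPairPreLie2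
    (d : g1 → g0) (m00 : g0 → g0 → g0) (m01 : g0 → g1 → g1) (m10 : g1 → g0 → g1)
    (d' : h1 → h0) (n00 : h0 → h0 → h0) (n01 : h0 → h1 → h1) (n10 : h1 → h0 → h1)
    (ρ00 : g0 → h0 → h0) (ρ01 : g0 → h1 → h1) (ρ1 : g1 → h0 → h1)
    (μ00 : g0 → h0 → h0) (μ01 : g0 → h1 → h1) (μ1 : g1 → h0 → h1)
    (ρ00' : h0 → g0 → g0) (ρ01' : h0 → g1 → g1) (ρ1' : h1 → g0 → g1)
    (μ00' : h0 → g0 → g0) (μ01' : h0 → g1 → g1) (μ1' : h1 → g0 → g1) : Prop where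
  alg : IsStrictPreLie2 K d m00 m01 m10
  alg' : IsStrictPreLie2 K d' n00 n01 n10
  rep : IsStrictRepPreLie2 K d m00 m01 m10 d' ρ00 ρ01 ρ1 μ00 μ01 μ1
  rep' : IsStrictRepPreLie2 K d' n00 n01 n10 d ρ00' ρ01' ρ1' μ00' μ01' μ1'
  eqM1 : ∀ a' x y, μ1' a' (m00 x y - m00 y x) =
      m01 x (μ1' a' y) - m01 y (μ1' a' x) + μ1' (ρ01 y a') x - μ1' (ρ01 x a') y
  eqM2 : ∀ a x' y', μ1 a (n00 x' y' - n00 y' x') =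
      n01 x' (μ1 a y') - n01 y' (μ1 a x') + μ1 (ρ01' y' a) x' - μ1 (ρ01' x' a) y'
  eqM3 : ∀ z' x y, μ00' z' (m00 x y - m00 y x) =
      m00 x (μ00' z' y) - m00 y (μ00' z' x) + μ00' (ρ00 y z') x - μ00' (ρ00 x z') y
  eqM4 : ∀ z x' y', μ00 z (n00 x' y' - n00 y' x') =
      n00 x' (μ00 z y') - n00 y' (μ00 z x') + μ00 (ρ00' y' z) x' - μ00 (ρ00' x' z) y'
  eqM5 : ∀ y' x a, μ01' y' (m01 x a - m10 a x) =
      m01 x (μ01' y' a) - m10 a (μ00' y' x) + μ1' (ρ1 a y') x - μ01' (ρ00 x y') a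
  eqM6 : ∀ y x' a', μ01 y (n01 x' a' - n10 a' x') =
      n01 x' (μ01 y a') - n10 a' (μ00 y x') + μ1 (ρ1' a' y) x' - μ01 (ρ00' x' y) a'
  eqM7 : ∀ x y' a', ρ01 x (n01 y' a') =
      n01 (ρ00 x y' - μ00 x y') a' + ρ01 (μ00' y' x - ρ00' y' x) a'
        + n01 y' (ρ01 x a') + μ1 (μ1' a' x) y'
  eqM8 : ∀ x' y a, ρ01' x' (m01 y a) =
      m01 (ρ00' x' y - μ00' x' y) a + ρ01' (μ00 y x' - ρ00 y x') a
        + m01 y (ρ01' x' a) + μ1' (μ1 a x') y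
  eqM9 : ∀ x a' y', ρ01 x (n10 a' y') =
      n10 (ρ01 x a' - μ01 x a') y' + ρ1 (μ1' a' x - ρ1' a' x) y'
        + n10 a' (ρ00 x y') + μ01 (μ00' y' x) a'
  eqM10 : ∀ x' a y, ρ01' x' (m10 a y) =
      m10 (ρ01' x' a - μ01' x' a) y + ρ1' (μ1 a x' - ρ1 a x') y
        + m10 a (ρ00' x' y) + μ01' (μ00 y x') a
  eqM11 : ∀ a x' y', ρ1 a (n00 x' y') =
      n10 (ρ1 a x' - μ1 a x') y' + ρ1 (μ01' x' a - ρ01' x' a) y'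
        + n01 x' (ρ1 a y') + μ1 (μ01' y' a) x'
  eqM12 : ∀ a' x y, ρ1' a' (m00 x y) =
      m10 (ρ1' a' x - μ1' a' x) y + ρ1' (μ01 x a' - ρ01 x a') y
        + m01 x (ρ1' a' y) + μ1' (μ01 y a') x
  eqM13 : ∀ x y' z', ρ00 x (n00 y' z') =
      n00 (ρ00 x y' - μ00 x y') z' + ρ00 (μ00' y' x - ρ00' y' x) z'
        + n00 y' (ρ00 x z') + μ00 (μ00' z' x) y'
  eqM14 : ∀ x' y z, ρ00' x' (m00 y z) =
      m00 (ρ00' x' y - μ00' x' y) z + ρ00' (μ00 y x' - ρ00 y x') z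
        + m00 y (ρ00' x' z) + μ00' (μ00 z x') y

end Matched

end PreLie2

open PreLie2 Module

/-- a Rota-Baxter operator of weight `0` on a strict associative 2-algebra
yields a strict pre-Lie 2-algebra. -/
theorem rotaBaxter_weight_zero_gives_strict_preLie2
    {K : Type*} [Field K] [CharZero K]
    {A0 A1 : Type*} [AddCommGroup A0] [Module K A0] [FiniteDimensional K A0]
    [AddCommGroup A1] [Module K A1] [FiniteDimensional K A1]
    (d : A1 →ₗ[K] A0) (m00 : A0 →ₗ[K] A0 →ₗ[K] A0) (m01 : A0 →ₗ[K] A1 →ₗ[K] A1)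
    (m10 : A1 →ₗ[K] A0 →ₗ[K] A1)
    (hA : IsStrictAssoc2 K (⇑d) (fun x y => m00 x y) (fun x a => m01 x a) (fun a x => m10 a x))
    (R0 : A0 →ₗ[K] A0) (R1 : A1 →ₗ[K] A1)
    (hchain : ∀ a, R0 (d a) = d (R1 a))
    (hrb00 : ∀ x y, R0 (m00 (R0 x) y + m00 x (R0 y)) = m00 (R0 x) (R0 y))
    (hrb01 : ∀ x a, R1 (m01 (R0 x) a + m01 x (R1 a)) = m01 (R0 x) (R1 a))
    (hrb10 : ∀ a x, R1 (m10 (R1 a) x + m10 a (R0 x)) = m10 (R1 a) (R0 x)) :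
    IsStrictPreLie2 K (⇑d)
      (fun x y => m00 (R0 x) y - m00 y (R0 x))
      (fun x a => m01 (R0 x) a - m10 a (R0 x))
      (fun a x => m10 (R1 a) x - m01 x (R1 a)) := by
  obtain ⟨hd, -, -, -, d01, d10, dmix, a000, a001, a010, a100⟩ := hA
  have rb00 x y : R0 (m00 x (R0 y)) = m00 (R0 x) (R0 y) - R0 (m00 (R0 x) y) := by
    rw [← hrb00, map_add, add_sub_cancel_left]
  have rb01 x a : R1 (m01 x (R1 a)) = m01 (R0 x) (R1 a) - R1 (m01 (R0 x) a) := by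
    rw [← hrb01, map_add, add_sub_cancel_left]
  have rb10 a x : R1 (m10 a (R0 x)) = m10 (R1 a) (R0 x) - R1 (m10 (R1 a) x) := by
    rw [← hrb10, map_add, add_sub_cancel_left]
  refine ⟨hd, ⟨fun x => ?_, fun y => ?_⟩, ⟨fun x => ?_, fun a => ?_⟩, ⟨fun a => ?_, fun x => ?_⟩,
    fun x a => ?_, fun a x => ?_, fun a b => ?_, fun x y z => ?_, fun x y a => ?_,
    fun a x y => ?_⟩
  · exact (m00 (R0 x) - m00.flip (R0 x)).isLinear
  · exact (m00.flip y ∘ₗ R0 - m00 y ∘ₗ R0).isLinear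
  · exact (m01 (R0 x) - m10.flip (R0 x)).isLinear
  · exact (m01.flip a ∘ₗ R0 - m10 a ∘ₗ R0).isLinear
  · exact (m10 (R1 a) - m01.flip (R1 a)).isLinear
  · exact (m10.flip x ∘ₗ R1 - m01 x ∘ₗ R1).isLinear
  · simp only [map_sub, d01, d10]
  · simp only [map_sub, d01, d10, hchain]
  · simp only [hchain, dmix]
  · simp only [map_sub, LinearMap.sub_apply, rb00, a000]
    abel
  · simp only [map_sub, LinearMap.sub_apply, rb00, a001, a010, a100]
    abel
  · simp only [map_sub, LinearMap.sub_apply, rb01, rb10, a001, a010, a100]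
    abel
end

section
/- Let A = (A0, A1, d, ·) be a strict pre-Lie 2-algebra with a nondegenerate invariant degree-1 bilinear form ω : A0 × A1 → K, and let A' = A0' ⊕ A1' and A'' = A0'' ⊕ A1'' be graded subspaces that are closed under d and under all three multiplications, with A0 = A0' ⊕ A0'', A1 = A1' ⊕ A1'', and isotropic: ω(A0', A1') = 0 and ω(A0'', A1'') = 0 (i.e. ((A,ω), A', A'') is a Manin triple of strict pre-Lie 2-algebras). Then, with [x,y] = x·y − y·x and [x,a] = x·a − a·x: (i) ω([x,y], a) + ω(y, [x,a]) − ω(x, [y,a]) = 0 and ω(d a, b) + ω(d b, a) = 0 for all x,y ∈ A0, a,b ∈ A1, so ω is a symplectic structure with vanishing degree-0 component on the subadjacent strict Lie 2-algebra G(A); (ii) A' and A'' are closed under the brackets, i.e. they are strict sub-Lie 2-algebras of G(A); (iii) A' and A'' are Lagrangian: A'^⊥ = A' and A''^⊥ = A'', where for a graded subspace U = U0 ⊕ U1 one sets U^⊥ = {x + a ∈ A0 ⊕ A1 : ω(x, b) = 0 for all b ∈ U1 and ω(y, a) = 0 for all y ∈ U0}. Hence ((G(A), ω), G(A'), G(A''))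 is a special para-Kähler strict Lie 2-algebra. -/
open PreLie2 Module

/-- If `S0 ⊕ S1` and `T0 ⊕ T1` are complementary graded subspaces, both isotropic for a form `ω`
that is injective on both sides, then `S0 ⊕ S1` is its own orthogonal. -/
theorem orthogonal_iff_mem_of_isCompl_of_isotropic {K A0 A1 : Type*} [Field K]
    [AddCommGroup A0] [Module K A0] [AddCommGroup A1] [Module K A1]
    (ω : A0 →ₗ[K] A1 →ₗ[K] K) (hl : Function.Injective ω) (hr : Function.Injective ω.flip)
    {S0 T0 : Submodule K A0} {S1 T1 : Submodule K A1}
    (hcompl0 : IsCompl S0 T0) (hcompl1 : IsCompl S1 T1)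
    (hS : ∀ x ∈ S0, ∀ a ∈ S1, ω x a = 0) (hT : ∀ x ∈ T0, ∀ a ∈ T1, ω x a = 0)
    (x : A0) (a : A1) :
    ((∀ b ∈ S1, ω x b = 0) ∧ ∀ y ∈ S0, ω y a = 0) ↔ (x ∈ S0 ∧ a ∈ S1) := by
  refine ⟨fun ⟨hx, ha⟩ => ⟨?_, ?_⟩, fun ⟨hx, ha⟩ => ⟨hS x hx, fun y hy => hS y hy a ha⟩⟩
  · obtain ⟨s, hs, t, ht, rfl⟩ :=
      Submodule.mem_sup.mp (hcompl0.sup_eq_top ▸ Submodule.mem_top : x ∈ S0 ⊔ T0)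
    have h0 : t = 0 := hl <| LinearMap.ext fun b => by
      obtain ⟨b₁, hb₁, b₂, hb₂, rfl⟩ :=
        Submodule.mem_sup.mp (hcompl1.sup_eq_top ▸ Submodule.mem_top : b ∈ S1 ⊔ T1)
      have h := hx b₁ hb₁
      rw [map_add, LinearMap.add_apply, hS s hs b₁ hb₁, zero_add] at h
      simp [h, hT t ht b₂ hb₂]
    simpa [h0] using hs
  · obtain ⟨s, hs, t, ht, rfl⟩ :=
      Submodule.mem_sup.mp (hcompl1.sup_eq_top ▸ Submodule.mem_top : a ∈ S1 ⊔ T1)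
    have h0 : t = 0 := hr <| LinearMap.ext fun y => by
      obtain ⟨y₁, hy₁, y₂, hy₂, rfl⟩ :=
        Submodule.mem_sup.mp (hcompl0.sup_eq_top ▸ Submodule.mem_top : y ∈ S0 ⊔ T0)
      have h := ha y₁ hy₁
      rw [map_add, hS y₁ hy₁ s hs, zero_add] at h
      simp [h, hT y₂ hy₂ t ht]
    simpa [h0] using hs

/-- a Manin triple of strict pre-Lie 2-algebras gives a special para-Kähler
strict Lie 2-algebra. -/
theorem manin_triple_gives_special_paraKahler
    {K : Type*} [Field K] [CharZero K]
    {A0 A1 : Type*} [AddCommGroup A0] [Module K A0] [FiniteDimensional K A0]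
    [AddCommGroup A1] [Module K A1] [FiniteDimensional K A1]
    (d : A1 →ₗ[K] A0) (m00 : A0 →ₗ[K] A0 →ₗ[K] A0) (m01 : A0 →ₗ[K] A1 →ₗ[K] A1)
    (m10 : A1 →ₗ[K] A0 →ₗ[K] A1)
    (hA : IsStrictPreLie2 K (⇑d) (fun x y => m00 x y) (fun x a => m01 x a) (fun a x => m10 a x))
    -- the nondegenerate invariant degree-1 bilinear form `ω : A0 × A1 → K`
    (ω : A0 →ₗ[K] A1 →ₗ[K] K)
    (hnd0 : Function.Bijective fun x => ω x)
    (hnd1 : Function.Bijective fun a => ω.flip a)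
    (hinv1 : ∀ a b, ω (d a) b = -ω (d b) a)
    (hinv2 : ∀ x y a, ω (m00 x y) a = -ω y (m01 x a - m10 a x))
    (hinv3 : ∀ x z b, ω z (m01 x b) = -ω (m00 x z - m00 z x) b)
    (hinv4 : ∀ z a y, ω z (m10 a y) = -ω y (m01 z a - m10 a z))
    -- the two graded subspaces `A' = S0 ⊕ S1` and `A'' = T0 ⊕ T1`
    (S0 T0 : Submodule K A0) (S1 T1 : Submodule K A1)
    (hcompl0 : IsCompl S0 T0) (hcompl1 : IsCompl S1 T1)
    (hdS : ∀ a ∈ S1, d a ∈ S0) (hdT : ∀ a ∈ T1, d a ∈ T0)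
    (hS00 : ∀ x ∈ S0, ∀ y ∈ S0, m00 x y ∈ S0)
    (hS01 : ∀ x ∈ S0, ∀ a ∈ S1, m01 x a ∈ S1)
    (hS10 : ∀ a ∈ S1, ∀ x ∈ S0, m10 a x ∈ S1)
    (hT00 : ∀ x ∈ T0, ∀ y ∈ T0, m00 x y ∈ T0)
    (hT01 : ∀ x ∈ T0, ∀ a ∈ T1, m01 x a ∈ T1)
    (hT10 : ∀ a ∈ T1, ∀ x ∈ T0, m10 a x ∈ T1)
    -- isotropy
    (hisoS : ∀ x ∈ S0, ∀ a ∈ S1, ω x a = 0)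
    (hisoT : ∀ x ∈ T0, ∀ a ∈ T1, ω x a = 0) :
    -- (i) `ω` is a closed (symplectic) degree-1 form on the subadjacent strict Lie 2-algebra
    ((∀ x y a, ω (m00 x y - m00 y x) a + ω y (m01 x a - m10 a x) - ω x (m01 y a - m10 a y) = 0)
      ∧ (∀ a b, ω (d a) b + ω (d b) a = 0))
    -- (ii) `A'` and `A''` are strict sub-Lie 2-algebras of `G(A)`
    ∧ ((∀ x ∈ S0, ∀ y ∈ S0, m00 x y - m00 y x ∈ S0)
      ∧ (∀ x ∈ S0, ∀ a ∈ S1, m01 x a - m10 a x ∈ S1)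
      ∧ (∀ x ∈ T0, ∀ y ∈ T0, m00 x y - m00 y x ∈ T0)
      ∧ (∀ x ∈ T0, ∀ a ∈ T1, m01 x a - m10 a x ∈ T1))
    -- (iii) `A'` and `A''` are Lagrangian: `A'^⊥ = A'` and `A''^⊥ = A''`
    ∧ ((∀ x a, ((∀ b ∈ S1, ω x b = 0) ∧ ∀ y ∈ S0, ω y a = 0) ↔ (x ∈ S0 ∧ a ∈ S1))
      ∧ (∀ x a, ((∀ b ∈ T1, ω x b = 0) ∧ ∀ y ∈ T0, ω y a = 0) ↔ (x ∈ T0 ∧ a ∈ T1))) := by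
  refine ⟨⟨fun x y a => ?_, fun a b => ?_⟩, ⟨?_, ?_, ?_, ?_⟩, ?_, ?_⟩
  · rw [map_sub, LinearMap.sub_apply, hinv2 x y a, hinv2 y x a]
    ring
  · rw [hinv1 a b, neg_add_cancel]
  · exact fun x hx y hy => sub_mem (hS00 x hx y hy) (hS00 y hy x hx)
  · exact fun x hx a ha => sub_mem (hS01 x hx a ha) (hS10 a ha x hx)
  · exact fun x hx y hy => sub_mem (hT00 x hx y hy) (hT00 y hy x hx)
  · exact fun x hx a ha => sub_mem (hT01 x hx a ha) (hT10 a ha x hx)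
  · exact orthogonal_iff_mem_of_isCompl_of_isotropic ω hnd0.injective hnd1.injective
      hcompl0 hcompl1 hisoS hisoT
  · exact orthogonal_iff_mem_of_isCompl_of_isotropic ω hnd0.injective hnd1.injective
      hcompl0.symm hcompl1.symm hisoT hisoS
end
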